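/- arXiv:1912.00983 — 3 statements merged into one kernel-verified Lean document; each statement's English description precedes it below -/
import Mathlib

section
/- Let d ≥ 1 and let ρ and σ be densities on ℂ^d such that ρ majorizes σ. Let a ∈ [0,1], b ∈ (0,1), and let ζ ∈ [0,1] satisfy ζ ≤ a · min{(1−b)/(d + a(1−b) + 1), b/((1 − a·b)·d + a·b + 1)}. Then D(ρ ‖ (1−ζ)·I/d + ζ·σ) ≥ (1−a) · D(ρ ‖ I/d). -/
open Matrix
open scoped ComplexOrder

/-- Matrix logarithm of a Hermitian matrix via functional calculus
(junk value `0` for non-Hermitian input). -/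
noncomputable def matLog {d : ℕ} (A : Matrix (Fin d) (Fin d) ℂ) : Matrix (Fin d) (Fin d) ℂ :=
  if hA : A.IsHermitian then hA.cfc Real.log else 0

/-- Umegaki relative entropy `D(ρ‖σ) = Re tr (ρ (log ρ - log σ))`. -/
noncomputable def relEnt {d : ℕ} (ρ σ : Matrix (Fin d) (Fin d) ℂ) : ℝ :=
  ((ρ * (matLog ρ - matLog σ)).trace).re

/-- A density matrix: positive semidefinite with trace one. -/
def IsDensity {d : ℕ} (ρ : Matrix (Fin d) (Fin d) ℂ) : Prop :=
  ρ.PosSemidef ∧ ρ.trace = 1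

/-- `ρ` majorizes `σ`: for every `k`, the maximum over `k`-element index sets of the
sum of corresponding eigenvalues of `ρ` dominates the analogous maximum for `σ`. -/
def Majorizes {d : ℕ} {ρ σ : Matrix (Fin d) (Fin d) ℂ}
    (hρ : ρ.IsHermitian) (hσ : σ.IsHermitian) : Prop :=
  ∀ k : ℕ, k ≤ d → ∀ T : Finset (Fin d), T.card = k →
    ∃ S : Finset (Fin d), S.card = k ∧ ∑ i ∈ T, hσ.eigenvalues i ≤ ∑ i ∈ S, hρ.eigenvalues i


/-- The real diagonal entries of `A` in the eigenbasis of the Hermitian matrix `B`. -/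
noncomputable def eigenbasisDiag {d : ℕ} {B : Matrix (Fin d) (Fin d) ℂ} (hB : B.IsHermitian)
    (A : Matrix (Fin d) (Fin d) ℂ) (j : Fin d) : ℝ :=
  ((star (hB.eigenvectorUnitary : Matrix (Fin d) (Fin d) ℂ) * A * hB.eigenvectorUnitary) j j).re

section Spectral

variable {d : ℕ} {A B : Matrix (Fin d) (Fin d) ℂ}

theorem trace_mul_cfc_re (hB : B.IsHermitian) (A : Matrix (Fin d) (Fin d) ℂ) (f : ℝ → ℝ) :
    (A * hB.cfc f).trace.re = ∑ j, f (hB.eigenvalues j) * eigenbasisDiag hB A j := by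
  have h : (A * hB.cfc f).trace =
      ((star (hB.eigenvectorUnitary : Matrix (Fin d) (Fin d) ℂ) * A *
        (hB.eigenvectorUnitary : Matrix (Fin d) (Fin d) ℂ)) *
        diagonal (RCLike.ofReal ∘ f ∘ hB.eigenvalues)).trace := by
    rw [IsHermitian.cfc, Unitary.conjStarAlgAut_apply, ← mul_assoc, trace_mul_comm]
    simp only [mul_assoc]
  rw [h, Matrix.trace, Complex.re_sum]
  refine Finset.sum_congr rfl fun j _ => ?_
  simp [eigenbasisDiag, mul_diagonal, mul_comm]

theorem cfc_id_eq_self (hB : B.IsHermitian) : hB.cfc (fun x => x) = B :=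
  hB.spectral_theorem.symm

theorem trace_mul_re (hB : B.IsHermitian) (A : Matrix (Fin d) (Fin d) ℂ) :
    (A * B).trace.re = ∑ j, hB.eigenvalues j * eigenbasisDiag hB A j := by
  rw [← trace_mul_cfc_re hB A (fun x => x), cfc_id_eq_self]

theorem sum_eigenbasisDiag (hB : B.IsHermitian) (A : Matrix (Fin d) (Fin d) ℂ) :
    ∑ j, eigenbasisDiag hB A j = A.trace.re := by
  have h := trace_mul_cfc_re hB A (fun _ => 1)
  have h1 : hB.cfc (fun _ => 1) = 1 := by
    rw [← IsHermitian.cfc_eq]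
    exact cfc_const_one ℝ B hB
  simpa [h1] using h.symm

theorem eigenbasisDiag_nonneg (hB : B.IsHermitian) (hA : A.PosSemidef) (j : Fin d) :
    0 ≤ eigenbasisDiag hB A j :=
  (Complex.le_def.1 (hA.conjTranspose_mul_mul_same _).diag_nonneg).1

theorem eigenbasisDiag_self (hB : B.IsHermitian) (j : Fin d) :
    eigenbasisDiag hB B j = hB.eigenvalues j := by
  have h := hB.conjStarAlgAut_star_eigenvectorUnitary
  rw [Unitary.conjStarAlgAut_apply] at h
  simp only [Unitary.coe_star, star_star] at h
  simp [eigenbasisDiag, h]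

theorem trace_mul_matLog_re (hB : B.IsHermitian) (A : Matrix (Fin d) (Fin d) ℂ) :
    (A * matLog B).trace.re = ∑ j, Real.log (hB.eigenvalues j) * eigenbasisDiag hB A j := by
  rw [matLog, dif_pos hB, trace_mul_cfc_re]

theorem matLog_smul_one (c : ℝ) :
    matLog (c • (1 : Matrix (Fin d) (Fin d) ℂ)) = Real.log c • 1 := by
  have hc : (c • (1 : Matrix (Fin d) (Fin d) ℂ)).IsHermitian := by
    simp [IsHermitian, conjTranspose_smul]
  rw [matLog, dif_pos hc, ← IsHermitian.cfc_eq, ← Algebra.algebraMap_eq_smul_one,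
    cfc_algebraMap, Algebra.algebraMap_eq_smul_one]

/-- Linearizing the logarithm at `1 / c`. -/
theorem trace_mul_matLog_le (hA : A.PosSemidef) (hB : B.PosDef) {c : ℝ} (hc : 0 < c) :
    (A * matLog B).trace.re ≤ c * (A * B).trace.re - (1 + Real.log c) * A.trace.re := by
  rw [trace_mul_matLog_re hB.1, trace_mul_re hB.1, ← sum_eigenbasisDiag hB.1 A, Finset.mul_sum,
    Finset.mul_sum, ← Finset.sum_sub_distrib]
  refine Finset.sum_le_sum fun j _ => ?_
  have hj := hB.eigenvalues_pos j
  have h := Real.log_le_sub_one_of_pos (mul_pos hc hj)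
  rw [Real.log_mul hc.ne' hj.ne'] at h
  nlinarith [eigenbasisDiag_nonneg hB.1 hA j]

theorem two_mul_trace_mul_re_le (hA : A.IsHermitian) (hB : B.IsHermitian) :
    2 * (A * B).trace.re ≤ (A * A).trace.re + (B * B).trace.re := by
  have h := (Complex.le_def.1 (posSemidef_conjTranspose_mul_self (A - B)).trace_nonneg).1
  rw [(hA.sub hB).eq] at h
  simp only [sub_mul, mul_sub, trace_sub, Complex.sub_re, Complex.zero_re] at h
  rw [trace_mul_comm B A] at h
  linarith

theorem trace_mul_self_re (hA : A.IsHermitian) :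
    (A * A).trace.re = ∑ i, hA.eigenvalues i ^ 2 := by
  simp [trace_mul_re hA, eigenbasisDiag_self, sq]

theorem eigenvalues_le_trace (hA : A.PosSemidef) (i : Fin d) :
    hA.1.eigenvalues i ≤ A.trace.re := by
  rw [← sum_eigenbasisDiag hA.1 A]
  simp only [eigenbasisDiag_self]
  exact Finset.single_le_sum (fun j _ => hA.eigenvalues_nonneg j) (Finset.mem_univ i)

end Spectral

theorem integral_max_sub_zero {q : ℝ} (h0 : 0 ≤ q) (h1 : q ≤ 1) :
    ∫ t in (0 : ℝ)..1, max (q - t) 0 = q ^ 2 / 2 := by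
  have hint (u v : ℝ) : IntervalIntegrable (fun t => max (q - t) 0) MeasureTheory.volume u v :=
    (by fun_prop : Continuous fun t => max (q - t) 0).intervalIntegrable u v
  rw [← intervalIntegral.integral_add_adjacent_intervals (hint 0 q) (hint q 1)]
  have e1 : ∫ t in (0 : ℝ)..q, max (q - t) 0 = ∫ t in (0 : ℝ)..q, (q - t) := by
    refine intervalIntegral.integral_congr fun t ht => ?_
    rw [Set.uIcc_of_le h0] at ht
    exact max_eq_left (sub_nonneg.2 ht.2)
  have e2 : ∫ t in q..1, max (q - t) 0 = ∫ t in q..1, (0 : ℝ) := by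
    refine intervalIntegral.integral_congr fun t ht => ?_
    rw [Set.uIcc_of_le h1] at ht
    exact max_eq_right (sub_nonpos.2 ht.1)
  rw [e1, e2, intervalIntegral.integral_sub intervalIntegrable_const
    intervalIntegral.intervalIntegrable_id]
  simp
  ring

/-- Majorization compares the sums of the hinge functions `x ↦ max (x - t) 0`. -/
theorem sum_max_sub_zero_le {ι : Type*} [Fintype ι] {p q : ι → ℝ}
    (h : ∀ T : Finset ι, ∃ S : Finset ι, S.card = T.card ∧ ∑ i ∈ T, q i ≤ ∑ i ∈ S, p i) (t : ℝ) :
    ∑ i, max (q i - t) 0 ≤ ∑ i, max (p i - t) 0 := by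
  classical
  obtain ⟨S, hcard, hS⟩ := h (Finset.univ.filter fun i => t ≤ q i)
  calc ∑ i, max (q i - t) 0
      = ∑ i ∈ Finset.univ.filter (fun i => t ≤ q i), (q i - t) := by
        rw [Finset.sum_filter]
        refine Finset.sum_congr rfl fun i _ => ?_
        split_ifs with hi
        · exact max_eq_left (sub_nonneg.2 hi)
        · exact max_eq_right (sub_nonpos.2 (not_le.1 hi).le)
    _ ≤ ∑ i ∈ S, (p i - t) := by
        simp only [Finset.sum_sub_distrib, Finset.sum_const, hcard]
        linarith
    _ ≤ ∑ i ∈ S, max (p i - t) 0 := Finset.sum_le_sum fun i _ => le_max_left _ _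
    _ ≤ ∑ i, max (p i - t) 0 :=
        Finset.sum_le_sum_of_subset_of_nonneg S.subset_univ fun i _ _ => le_max_right _ _

theorem sum_sq_le_of_majorizes {ι : Type*} [Fintype ι] {p q : ι → ℝ}
    (hp : ∀ i, p i ∈ Set.Icc (0 : ℝ) 1) (hq : ∀ i, q i ∈ Set.Icc (0 : ℝ) 1)
    (h : ∀ T : Finset ι, ∃ S : Finset ι, S.card = T.card ∧ ∑ i ∈ T, q i ≤ ∑ i ∈ S, p i) :
    ∑ i, q i ^ 2 ≤ ∑ i, p i ^ 2 := by
  have key {r : ι → ℝ} (hr : ∀ i, r i ∈ Set.Icc (0 : ℝ) 1) :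
      ∫ t in (0 : ℝ)..1, ∑ i, max (r i - t) 0 = (∑ i, r i ^ 2) / 2 := by
    rw [intervalIntegral.integral_finsetSum, Finset.sum_div]
    · exact Finset.sum_congr rfl fun i _ => integral_max_sub_zero (hr i).1 (hr i).2
    · exact fun i _ =>
        (by fun_prop : Continuous fun t => max (r i - t) 0).intervalIntegrable 0 1
  have hint (r : ι → ℝ) : IntervalIntegrable (fun t => ∑ i, max (r i - t) 0)
      MeasureTheory.volume 0 1 :=
    (by fun_prop : Continuous fun t => ∑ i, max (r i - t) 0).intervalIntegrable 0 1
  have := intervalIntegral.integral_mono_on zero_le_one (hint q) (hint p)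
    fun t _ => sum_max_sub_zero_le h t
  rw [key hp, key hq] at this
  linarith

/-- A quadratic lower bound for `x log x - x + 1` on `[0, D]`. -/
theorem sq_div_le_mul_log {x D : ℝ} (hx : 0 ≤ x) (hxD : x ≤ D) (hD : 1 ≤ D) :
    (x - 1) ^ 2 / (D + 1) ≤ x * Real.log x - x + 1 := by
  rcases le_total 1 x with h1 | h1
  · have h := Real.le_log_one_add_of_nonneg (sub_nonneg.2 h1)
    rw [show 1 + (x - 1) = x by ring, show x - 1 + 2 = x + 1 by ring] at h
    calc (x - 1) ^ 2 / (D + 1) ≤ (x - 1) ^ 2 / (x + 1) := by gcongr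
      _ = x * (2 * (x - 1) / (x + 1)) - x + 1 := by field_simp; ring
      _ ≤ x * Real.log x - x + 1 := by gcongr
  · have h2 : (x - 1) ^ 2 / (D + 1) ≤ (x - 1) ^ 2 / 2 := by gcongr; linarith
    rcases hx.eq_or_lt with rfl | hx0
    · norm_num at h2 ⊢
      linarith
    · have h := Real.self_le_sinh_iff.2 (Real.log_nonneg ((one_le_inv₀ hx0).2 h1))
      rw [Real.sinh_log (inv_pos.2 hx0), Real.log_inv, inv_inv] at h
      have h3 := mul_le_mul_of_nonneg_left h hx
      have h4 : x * x⁻¹ = 1 := mul_inv_cancel₀ hx0.ne'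
      nlinarith

theorem sum_mul_sub_one_sq {d : ℕ} {p : Fin d → ℝ} (hsum : ∑ i, p i = 1) :
    ∑ i, (d * p i - 1) ^ 2 = d * (d * ∑ i, p i ^ 2 - 1) := by
  have (i : Fin d) : (d * p i - 1) ^ 2 = (d : ℝ) ^ 2 * p i ^ 2 - 2 * d * p i + 1 := by ring
  simp only [this, Finset.sum_add_distrib, Finset.sum_sub_distrib, ← Finset.mul_sum, hsum]
  simp
  ring

/-- Entropy deficit of a probability vector versus its collision excess. -/
theorem sum_sq_excess_le_entropy {d : ℕ} (hd : 1 ≤ d) {p : Fin d → ℝ}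
    (hp : ∀ i, p i ∈ Set.Icc (0 : ℝ) 1) (hsum : ∑ i, p i = 1) :
    (d * ∑ i, p i ^ 2 - 1) / (d + 1) ≤ ∑ i, Real.log (p i) * p i + Real.log d := by
  have hD : (1 : ℝ) ≤ d := by exact_mod_cast hd
  have hD0 : (0 : ℝ) < d := by linarith
  have h : ∑ i, (d * p i - 1) ^ 2 / ((d : ℝ) + 1) ≤
      ∑ i, (d * (Real.log (p i) * p i) + d * Real.log d * p i - d * p i + 1) := by
    refine Finset.sum_le_sum fun i _ => ?_
    have hi := sq_div_le_mul_log (mul_nonneg hD0.le (hp i).1)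
      (mul_le_of_le_one_right hD0.le (hp i).2) hD
    refine hi.trans (le_of_eq ?_)
    rcases (hp i).1.eq_or_lt with h0 | h0
    · simp [← h0]
    · rw [Real.log_mul hD0.ne' h0.ne']
      ring
  rw [← Finset.sum_div, sum_mul_sub_one_sq hsum] at h
  simp only [Finset.sum_add_distrib, Finset.sum_sub_distrib, ← Finset.mul_sum, hsum] at h
  simp only [Finset.sum_const, Finset.card_univ, Fintype.card_fin, nsmul_eq_mul, mul_one] at h
  rw [mul_div_assoc] at h
  exact le_of_mul_le_mul_left (by linarith) hD0

/-- **Theorem 1.2.** Multiplicative perturbation of relative entropy to the complete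
mixture, for a density `ρ` majorizing `σ`. -/
theorem relEnt_perturbed_complete_mixture_ge
    (d : ℕ) (hd : 1 ≤ d) (ρ σ : Matrix (Fin d) (Fin d) ℂ)
    (hρ : IsDensity ρ) (hσ : IsDensity σ)
    (hmaj : Majorizes hρ.1.1 hσ.1.1)
    (a b ζ : ℝ) (ha : a ∈ Set.Icc (0:ℝ) 1) (hb : b ∈ Set.Ioo (0:ℝ) 1)
    (hζ : ζ ∈ Set.Icc (0:ℝ) 1)
    (hζle : ζ ≤ a * min ((1 - b) / (d + a * (1 - b) + 1))
      (b / ((1 - a * b) * d + a * b + 1))) :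
    relEnt ρ ((1 - ζ) • ((d : ℝ)⁻¹ • (1 : Matrix (Fin d) (Fin d) ℂ)) + ζ • σ)
      ≥ (1 - a) * relEnt ρ ((d : ℝ)⁻¹ • (1 : Matrix (Fin d) (Fin d) ℂ)) := by
  have hD : (1 : ℝ) ≤ d := by exact_mod_cast hd
  have hD0 : (0 : ℝ) < d := by linarith
  obtain ⟨ha0, ha1⟩ := ha
  obtain ⟨hb0, hb1⟩ := hb
  obtain ⟨hρ0, hρ1⟩ := hρ
  obtain ⟨hσ0, hσ1⟩ := hσ
  have hζa : ζ ≤ a / (d + 1) := by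
    refine hζle.trans ?_
    rw [div_eq_mul_one_div a]
    gcongr
    refine (min_le_left _ _).trans ?_
    gcongr
    · linarith
    · nlinarith
  have hζ1 : ζ < 1 := hζa.trans_lt ((div_lt_one (by linarith)).2 (by linarith))
  have hτ : ((1 - ζ) • ((d : ℝ)⁻¹ • (1 : Matrix (Fin d) (Fin d) ℂ)) + ζ • σ).PosDef :=
    ((PosDef.one.smul (inv_pos.2 hD0)).smul (sub_pos.2 hζ1)).add_posSemidef (hσ0.smul hζ.1)
  have hp (i : Fin d) : hρ0.1.eigenvalues i ∈ Set.Icc (0 : ℝ) 1 :=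
    ⟨hρ0.eigenvalues_nonneg i, by simpa [hρ1] using eigenvalues_le_trace hρ0 i⟩
  have hq (i : Fin d) : hσ0.1.eigenvalues i ∈ Set.Icc (0 : ℝ) 1 :=
    ⟨hσ0.eigenvalues_nonneg i, by simpa [hσ1] using eigenvalues_le_trace hσ0 i⟩
  have hsum : ∑ i, hρ0.1.eigenvalues i = 1 := by
    simpa [eigenbasisDiag_self, hρ1] using sum_eigenbasisDiag hρ0.1 ρ
  have hsq : (σ * σ).trace.re ≤ (ρ * ρ).trace.re := by
    rw [trace_mul_self_re hρ0.1, trace_mul_self_re hσ0.1]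
    exact sum_sq_le_of_majorizes hp hq fun T =>
      hmaj T.card (by simpa using T.card_le_univ) T rfl
  have hcross := two_mul_trace_mul_re_le hρ0.1 hσ0.1
  have hent := sum_sq_excess_le_entropy hd hp hsum
  have hlog : (ρ * matLog ρ).trace.re =
      ∑ i, Real.log (hρ0.1.eigenvalues i) * hρ0.1.eigenvalues i := by
    simp [trace_mul_matLog_re hρ0.1, eigenbasisDiag_self]
  rw [← trace_mul_self_re, ← hlog] at hent
  have hP : 0 ≤ d * (ρ * ρ).trace.re - 1 := by
    have h := Finset.sum_nonneg fun i (_ : i ∈ Finset.univ) =>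
      sq_nonneg (d * hρ0.1.eigenvalues i - 1)
    rw [sum_mul_sub_one_sq hsum, ← trace_mul_self_re] at h
    exact nonneg_of_mul_nonneg_right h hD0
  have hbound := trace_mul_matLog_le hρ0 hτ hD0
  have hmix : (ρ * ((1 - ζ) • ((d : ℝ)⁻¹ • (1 : Matrix (Fin d) (Fin d) ℂ)) + ζ • σ)).trace.re =
      (1 - ζ) * (d : ℝ)⁻¹ + ζ * (ρ * σ).trace.re := by
    simp only [mul_add, mul_smul_comm, mul_one, trace_add, trace_smul, hρ1, Complex.add_re,
      Complex.smul_re, Complex.one_re, smul_eq_mul]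
  have hunif : (ρ * matLog ((d : ℝ)⁻¹ • (1 : Matrix (Fin d) (Fin d) ℂ))).trace.re =
      -Real.log d := by
    simp only [matLog_smul_one, mul_smul_comm, mul_one, trace_smul, hρ1, Complex.smul_re,
      Complex.one_re, smul_eq_mul, Real.log_inv]
  rw [hmix, hρ1, Complex.one_re, mul_one] at hbound
  simp only [relEnt, mul_sub, trace_sub, Complex.sub_re, hunif]
  have hQP : (ρ * σ).trace.re ≤ (ρ * ρ).trace.re := by linarith
  have hζQ : ζ * (d * (ρ * σ).trace.re - 1) ≤
      a * ((ρ * matLog ρ).trace.re + Real.log d) :=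
    calc ζ * (d * (ρ * σ).trace.re - 1) ≤ ζ * (d * (ρ * ρ).trace.re - 1) := by
          have := hζ.1
          gcongr
      _ ≤ a / (d + 1) * (d * (ρ * ρ).trace.re - 1) := by gcongr
      _ = a * ((d * (ρ * ρ).trace.re - 1) / (d + 1)) := by ring
      _ ≤ _ := by gcongr
  have hexp : d * ((1 - ζ) * (d : ℝ)⁻¹ + ζ * (ρ * σ).trace.re) =
      1 + ζ * (d * (ρ * σ).trace.re - 1) := by
    field_simp
    ring
  linarith
end

section
/- Let d ≥ 1, let ρ and σ be densities on ℂ^d such that ρ majorizes σ, and let ζ ∈ [0,1). Then D(ρ ‖ (1−ζ)·I/d + ζ·σ) ≥ D(ρ ‖ (1−ζ)·I/d + ζ·ρ). -/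
open Matrix
open scoped ComplexOrder

/-- A bilinear form given by a doubly stochastic matrix is bounded by its value at some
permutation. -/
lemma exists_perm_bilin_le_of_mem_doublyStochastic {n : Type*} [Fintype n] [DecidableEq n]
    {M : Matrix n n ℝ} (hM : M ∈ doublyStochastic ℝ n) (a b : n → ℝ) :
    ∃ π : Equiv.Perm n, ∑ i, ∑ j, M i j * (a i * b j) ≤ ∑ i, a i * b (π i) := by
  let L : Matrix n n ℝ →ₗ[ℝ] ℝ :=
    { toFun := fun N => ∑ i, ∑ j, N i j * (a i * b j)
      map_add' := fun N N' => by simp [add_mul, Finset.sum_add_distrib]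
      map_smul' := fun c N => by simp [Finset.mul_sum, mul_assoc] }
  rw [← SetLike.mem_coe, doublyStochastic_eq_convexHull_permMatrix] at hM
  obtain ⟨_, ⟨π, rfl⟩, hπ⟩ :=
    (L.convexOn convex_univ).exists_ge_of_mem_convexHull (Set.subset_univ _) hM
  refine ⟨π, hπ.trans (le_of_eq ?_)⟩
  refine Finset.sum_congr rfl fun i _ => ?_
  simp [Equiv.Perm.permMatrix, PEquiv.toMatrix_apply, Equiv.toPEquiv_apply]

/-- Entrywise squared norms of a unitary matrix form a doubly stochastic matrix. -/
lemma normSq_unitary_mem_doublyStochastic {n : Type*} [Fintype n] [DecidableEq n]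
    (W : Matrix.unitaryGroup n ℂ) :
    (Matrix.of fun i j => Complex.normSq (W.1 i j)) ∈ doublyStochastic ℝ n := by
  rw [mem_doublyStochastic_iff_sum]
  refine ⟨fun i j => Complex.normSq_nonneg _, fun i => ?_, fun j => ?_⟩
  · have h := congrFun (congrFun (Matrix.mem_unitaryGroup_iff.mp W.2) i) i
    rw [Matrix.mul_apply] at h
    have h' := congrArg Complex.re h
    simpa [Matrix.star_apply, Complex.mul_conj] using h'
  · have h := congrFun (congrFun (Matrix.mem_unitaryGroup_iff'.mp W.2) j) j
    rw [Matrix.mul_apply] at h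
    have h' := congrArg Complex.re h
    simpa [Matrix.star_apply, mul_comm, Complex.mul_conj] using h'

/-- A set containing the largest values of `p` maximizes the sum of `p` among sets of the same
cardinality. -/
lemma sum_le_sum_of_card_eq_of_upper {n : Type*} [Fintype n] [DecidableEq n] (p : n → ℝ)
    {A S : Finset n} (hA : ∀ i ∈ A, ∀ j ∉ A, p j ≤ p i) (hcard : S.card = A.card) :
    ∑ i ∈ S, p i ≤ ∑ i ∈ A, p i := by
  rcases A.eq_empty_or_nonempty with rfl | hne
  · simp [Finset.card_eq_zero.mp (by simpa using hcard)]
  · obtain ⟨m, hm, hmin⟩ := A.exists_min_image p hne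
    have key : ∑ i ∈ S, (p i - p m) ≤ ∑ i ∈ A, (p i - p m) := by
      calc ∑ i ∈ S, (p i - p m) ≤ ∑ i ∈ S, if i ∈ A then p i - p m else 0 := by
            refine Finset.sum_le_sum fun i _ => ?_
            split_ifs with h
            · exact le_rfl
            · exact sub_nonpos.mpr (hA m hm i h)
        _ ≤ ∑ i, if i ∈ A then p i - p m else 0 := by
            refine Finset.sum_le_sum_of_subset_of_nonneg (Finset.subset_univ _) fun i _ _ => ?_
            split_ifs with h
            · exact sub_nonneg.mpr (hmin i h)
            · exact le_rfl
        _ = ∑ i ∈ A, (p i - p m) := by simp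
    simpa [Finset.sum_sub_distrib, hcard] using key

/-- Abel summation: a nonnegative weighted sum is nonpositive when all sums over superlevel sets
of the weight at positive levels are. -/
lemma sum_mul_nonpos_of_superlevel {n : Type*} [DecidableEq n] (x : n → ℝ) (s : Finset n) :
    ∀ a : n → ℝ, (∀ i ∈ s, 0 ≤ a i) → (∀ t > 0, ∑ i ∈ s with t ≤ a i, x i ≤ 0) →
      ∑ i ∈ s, a i * x i ≤ 0 := by
  induction s using Finset.strongInduction with
  | H s ih =>
    intro a ha hx
    rcases s.eq_empty_or_nonempty with rfl | hne
    · simp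
    obtain ⟨m, hm, hmin⟩ := s.exists_min_image a hne
    have hall : a m * ∑ i ∈ s, x i ≤ 0 := by
      rcases (ha m hm).eq_or_lt with h0 | h0
      · simp [← h0]
      · have h := hx (a m) h0
        rw [Finset.filter_true_of_mem hmin] at h
        exact mul_nonpos_of_nonneg_of_nonpos h0.le h
    have hrest : ∑ i ∈ s.erase m, (a i - a m) * x i ≤ 0 := by
      refine ih _ (Finset.erase_ssubset hm) (fun i => a i - a m)
        (fun i hi => sub_nonneg.mpr (hmin i (Finset.mem_of_mem_erase hi))) fun t ht => ?_
      have hset : {i ∈ s.erase m | t ≤ a i - a m} = {i ∈ s | t + a m ≤ a i} := by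
        ext i
        simp only [Finset.mem_filter, Finset.mem_erase]
        constructor
        · rintro ⟨⟨_, hi⟩, h⟩
          exact ⟨hi, by linarith⟩
        · rintro ⟨hi, h⟩
          refine ⟨⟨?_, hi⟩, by linarith⟩
          rintro rfl
          linarith
      rw [hset]
      exact hx _ (by linarith [ha m hm])
    rw [← Finset.add_sum_erase _ _ hm] at hall ⊢
    have hexp : ∑ i ∈ s.erase m, (a i - a m) * x i
        = ∑ i ∈ s.erase m, a i * x i - a m * ∑ i ∈ s.erase m, x i := by
      simp [sub_mul, Finset.sum_sub_distrib, Finset.mul_sum]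
    rw [mul_add] at hall
    linarith

/-- If every sum of values of `q` is dominated by a sum of as many values of `p`, then pairing
`p` against a concave increasing function of `q` is maximized at `q = p`, here for
`x ↦ log (c + ζ x)`. -/
lemma sum_mul_log_affine_le {n : Type*} [Fintype n] [DecidableEq n] {p q : n → ℝ} {c ζ : ℝ}
    (hp : ∀ i, 0 ≤ p i) (hq : ∀ i, 0 ≤ q i) (hc : 0 < c) (hζ : 0 ≤ ζ)
    (hmaj : ∀ T : Finset n, ∃ S : Finset n, S.card = T.card ∧ ∑ i ∈ T, q i ≤ ∑ i ∈ S, p i) :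
    ∑ i, p i * Real.log (c + ζ * q i) ≤ ∑ i, p i * Real.log (c + ζ * p i) := by
  have hpos : ∀ x, 0 ≤ x → 0 < c + ζ * x := fun x hx => by positivity
  have htangent : ∀ i, p i * Real.log (c + ζ * q i) ≤
      p i * Real.log (c + ζ * p i) + p i * ζ / (c + ζ * p i) * (q i - p i) := by
    intro i
    have hpi := hpos _ (hp i)
    have hqi := hpos _ (hq i)
    have h := Real.log_le_sub_one_of_pos (div_pos hqi hpi)
    rw [Real.log_div hqi.ne' hpi.ne'] at h
    have h' : (c + ζ * q i) / (c + ζ * p i) - 1 = ζ / (c + ζ * p i) * (q i - p i) := by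
      field_simp
      ring
    rw [h'] at h
    calc p i * Real.log (c + ζ * q i)
        ≤ p i * (Real.log (c + ζ * p i) + ζ / (c + ζ * p i) * (q i - p i)) :=
          mul_le_mul_of_nonneg_left (by linarith) (hp i)
      _ = _ := by ring
  have hmono : ∀ i j, p i * ζ / (c + ζ * p i) < p j * ζ / (c + ζ * p j) → p i ≤ p j := by
    intro i j h
    by_contra! hlt
    refine h.not_ge ?_
    rw [div_le_div_iff₀ (hpos _ (hp j)) (hpos _ (hp i))]
    nlinarith [mul_nonneg (mul_nonneg hc.le hζ) (sub_nonneg.mpr hlt.le)]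
  have habel : ∑ i, p i * ζ / (c + ζ * p i) * (q i - p i) ≤ 0 := by
    refine sum_mul_nonpos_of_superlevel _ _ _
      (fun i _ => div_nonneg (mul_nonneg (hp i) hζ) (hpos _ (hp i)).le) fun t _ => ?_
    rw [Finset.sum_sub_distrib, sub_nonpos]
    obtain ⟨S, hS, hle⟩ := hmaj {i | t ≤ p i * ζ / (c + ζ * p i)}
    refine hle.trans (sum_le_sum_of_card_eq_of_upper p (fun i hi j hj => ?_) hS)
    simp only [Finset.mem_filter, Finset.mem_univ, true_and, not_le] at hi hj
    exact hmono j i (hj.trans_le hi)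
  have h := Finset.sum_le_sum fun i (_ : i ∈ Finset.univ) => htangent i
  rw [Finset.sum_add_distrib] at h
  linarith

/-- The trace of a product of a Hermitian matrix with a function of another one, in terms of
eigenvalues and overlaps of the eigenbases. -/
lemma re_trace_mul_cfc {n : Type*} [Fintype n] [DecidableEq n] {A B : Matrix n n ℂ}
    (hA : A.IsHermitian) (hB : B.IsHermitian) (f : ℝ → ℝ) :
    (A * hB.cfc f).trace.re =
      ∑ i, ∑ j, Complex.normSq ((star hA.eigenvectorUnitary * hB.eigenvectorUnitary).1 i j) *
        (hA.eigenvalues i * f (hB.eigenvalues j)) := by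
  set U := hA.eigenvectorUnitary with hU
  set V := hB.eigenvectorUnitary with hV
  have h : (A * hB.cfc f).trace =
      (diagonal (RCLike.ofReal ∘ hA.eigenvalues : n → ℂ) * (star U * V).1 *
        diagonal (RCLike.ofReal ∘ f ∘ hB.eigenvalues : n → ℂ) * star (star U * V).1).trace := by
    conv_lhs => rw [hA.spectral_theorem]
    rw [IsHermitian.cfc, Unitary.conjStarAlgAut_apply, Unitary.conjStarAlgAut_apply, ← hU, ← hV]
    simp only [mul_assoc]
    rw [Matrix.trace_mul_comm]
    simp [mul_assoc]
  rw [h, Matrix.trace, Complex.re_sum]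
  refine Finset.sum_congr rfl fun i _ => ?_
  rw [Matrix.diag_apply, Matrix.mul_apply, Complex.re_sum]
  refine Finset.sum_congr rfl fun j _ => ?_
  rw [Matrix.mul_diagonal, Matrix.diagonal_mul, Matrix.star_apply]
  generalize (star U * V).1 i j = z
  simp [Complex.normSq_apply]
  ring

/-- The logarithm of an affine function of a Hermitian matrix. -/
lemma matLog_affine {d : ℕ} {A : Matrix (Fin d) (Fin d) ℂ} (hA : A.IsHermitian) {c ζ : ℝ}
    (hpos : ∀ i, 0 < c + ζ * hA.eigenvalues i) :
    matLog (c • (1 : Matrix (Fin d) (Fin d) ℂ) + ζ • A) =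
      hA.cfc fun x => Real.log (c + ζ * x) := by
  have hsa : IsSelfAdjoint A := hA
  have hB : (c • (1 : Matrix (Fin d) (Fin d) ℂ) + ζ • A).IsHermitian := by
    have h : IsSelfAdjoint (c • (1 : Matrix (Fin d) (Fin d) ℂ) + ζ • A) :=
      ((IsSelfAdjoint.all c).smul (.one _)).add ((IsSelfAdjoint.all ζ).smul hsa)
    exact h
  have haff : cfc (fun x : ℝ => c + ζ * x) A = c • (1 : Matrix (Fin d) (Fin d) ℂ) + ζ • A := by
    rw [cfc_const_add c (fun x => ζ * x) A, cfc_const_mul_id ζ A, Algebra.algebraMap_eq_smul_one]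
  have hlog : ContinuousOn Real.log ((fun x : ℝ => c + ζ * x) '' spectrum ℝ A) := by
    refine Real.continuousOn_log.mono ?_
    rintro _ ⟨x, hx, rfl⟩
    rw [hA.spectrum_real_eq_range_eigenvalues] at hx
    obtain ⟨i, rfl⟩ := hx
    exact (hpos i).ne'
  rw [matLog, dif_pos hB, ← hB.cfc_eq, ← hA.cfc_eq, cfc_comp' Real.log _ A hlog, haff]

/-- **Proposition 1.3.** Among all `σ` majorized by `ρ`, the perturbation by `ρ` itself
minimizes the relative entropy to the perturbed complete mixture. -/
theorem relEnt_perturbed_self_le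
    (d : ℕ) (hd : 1 ≤ d) (ρ σ : Matrix (Fin d) (Fin d) ℂ)
    (hρ : IsDensity ρ) (hσ : IsDensity σ)
    (hmaj : Majorizes hρ.1.1 hσ.1.1)
    (ζ : ℝ) (hζ : ζ ∈ Set.Ico (0:ℝ) 1) :
    relEnt ρ ((1 - ζ) • ((d : ℝ)⁻¹ • (1 : Matrix (Fin d) (Fin d) ℂ)) + ζ • σ)
      ≥ relEnt ρ ((1 - ζ) • ((d : ℝ)⁻¹ • (1 : Matrix (Fin d) (Fin d) ℂ)) + ζ • ρ) := by
  have hc : 0 < (1 - ζ) * (d : ℝ)⁻¹ := mul_pos (by linarith [hζ.2]) (by positivity)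
  have hp := hρ.1.eigenvalues_nonneg
  have hq := hσ.1.eigenvalues_nonneg
  have hpos : ∀ x : ℝ, 0 ≤ x → 0 < (1 - ζ) * (d : ℝ)⁻¹ + ζ * x := fun x hx =>
    add_pos_of_pos_of_nonneg hc (mul_nonneg hζ.1 hx)
  rw [smul_smul, ge_iff_le, relEnt, relEnt, mul_sub, mul_sub, trace_sub, trace_sub,
    Complex.sub_re, Complex.sub_re, matLog_affine hρ.1.1 fun i => hpos _ (hp i),
    matLog_affine hσ.1.1 fun i => hpos _ (hq i)]
  refine sub_le_sub_left ?_ _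
  obtain ⟨π, hπ⟩ := exists_perm_bilin_le_of_mem_doublyStochastic
    (normSq_unitary_mem_doublyStochastic
      (star hρ.1.1.eigenvectorUnitary * hσ.1.1.eigenvectorUnitary))
    hρ.1.1.eigenvalues
    (fun j => Real.log ((1 - ζ) * (d : ℝ)⁻¹ + ζ * hσ.1.1.eigenvalues j))
  have hself : (ρ * hρ.1.1.cfc fun x => Real.log ((1 - ζ) * (d : ℝ)⁻¹ + ζ * x)).trace.re =
      ∑ i, hρ.1.1.eigenvalues i *
        Real.log ((1 - ζ) * (d : ℝ)⁻¹ + ζ * hρ.1.1.eigenvalues i) := by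
    rw [re_trace_mul_cfc hρ.1.1 hρ.1.1]
    simp [Matrix.one_apply, apply_ite Complex.normSq]
  rw [hself, re_trace_mul_cfc hρ.1.1 hσ.1.1]
  refine hπ.trans (sum_mul_log_affine_le hp (fun i => hq (π i)) hc hζ.1 fun T => ?_)
  obtain ⟨S, hS, hle⟩ := hmaj T.card (by simpa using T.card_le_univ)
    (T.map π.toEmbedding) (T.card_map _)
  exact ⟨S, hS, by simpa using hle⟩
end

section
/- Let ρ, σ, ω be densities on ℂ^d with σ positive definite, and let ζ ∈ (0,1) and c ≥ 1 satisfy (1−ζ)σ ≤ ω ≤ (1 + ζ(c−1))σ in the Loewner order. Set η := (ω − (1−ζ)σ)/ζ. Then η is positive semidefinite with trace 1; and if moreover η is positive definite, then (1−ζ)² · D(ρ‖σ) ≤ (1 + ζ(c+1) + 2ζ²(c−1)) · D(ρ‖ω) + ζ(2+ζ)·c · D(ρ‖η). -/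
open Matrix
open scoped ComplexOrder

namespace Matrix

theorem PosDef.add_smul_sub {n : Type*} {P Q : Matrix n n ℂ} (hP : P.PosDef) (hQ : Q.PosDef)
    {t : ℝ}
    (ht : t ∈ Set.Icc (0 : ℝ) 1) : (Q + t • (P - Q)).PosDef := by
  have h : Q + t • (P - Q) = (1 - t) • Q + t • P := by module
  rw [h]
  rcases ht.1.eq_or_lt with rfl | h0
  · simpa using hQ
  · exact (hP.smul h0).posSemidef_add (hQ.posSemidef.smul (sub_nonneg.2 ht.2))

variable {n : Type*} [Fintype n] [DecidableEq n]

theorem PosSemidef.re_trace_mul_nonneg {A B : Matrix n n ℂ} (hA : A.PosSemidef)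
    (hB : B.PosSemidef) : 0 ≤ (A * B).trace.re := by
  open scoped MatrixOrder in
  obtain ⟨C, rfl⟩ := CStarAlgebra.nonneg_iff_eq_star_mul_self.1 hA.nonneg
  rw [mul_assoc, trace_mul_comm]
  exact (Complex.le_def.1 (hB.mul_mul_conjTranspose_same C).trace_nonneg).1

/-- The quadratic form `X ↦ Re tr (A X B X)`. -/
noncomputable def traceForm (A B X : Matrix n n ℂ) : ℝ := (A * X * B * X).trace.re

theorem PosSemidef.traceForm_nonneg {A B X : Matrix n n ℂ} (hA : A.PosSemidef)
    (hB : B.PosSemidef) (hX : X.IsHermitian) : 0 ≤ traceForm A B X := by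
  have h := hB.mul_mul_conjTranspose_same X
  rw [hX.eq] at h
  simpa [traceForm, mul_assoc] using hA.re_trace_mul_nonneg h

theorem traceForm_mono {A A' B B' X : Matrix n n ℂ} (hA : A.PosSemidef) (hB' : B'.PosSemidef)
    (hAA' : (A' - A).PosSemidef) (hBB' : (B' - B).PosSemidef) (hX : X.IsHermitian) :
    traceForm A B X ≤ traceForm A' B' X := by
  have h₁ := hA.traceForm_nonneg hBB' hX
  have h₂ := hAA'.traceForm_nonneg hB' hX
  simp only [traceForm, mul_sub, sub_mul, trace_sub, Complex.sub_re] at *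
  linarith

theorem traceForm_smul_smul (A B X : Matrix n n ℂ) (k : ℝ) :
    traceForm (k • A) (k • B) X = k ^ 2 * traceForm A B X := by
  simp [traceForm, trace_smul, smul_smul, pow_two, mul_assoc]

theorem traceForm_sub_smul_le {A B Y Z : Matrix n n ℂ} (hA : A.PosSemidef) (hB : B.PosSemidef)
    (hY : Y.IsHermitian) (hZ : Z.IsHermitian) {ζ : ℝ} (hζ : 0 ≤ ζ) :
    traceForm A B (Y - ζ • Z) ≤ (1 + ζ) * traceForm A B Y + ζ * (1 + ζ) * traceForm A B Z := by
  have h := mul_nonneg hζ (hA.traceForm_nonneg hB (hY.add hZ))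
  simp only [traceForm, mul_sub, sub_mul, mul_add, add_mul, trace_sub, trace_add, trace_smul,
    smul_mul_assoc, mul_smul_comm, Complex.sub_re, Complex.add_re, Complex.smul_re, smul_eq_mul]
    at *
  linarith

theorem PosDef.posSemidef_inv_sub_inv {A B : Matrix n n ℂ} (hA : A.PosDef)
    (hAB : (B - A).PosSemidef) : (A⁻¹ - B⁻¹).PosSemidef := by
  have hB : B.PosDef := by simpa using hA.add_posSemidef hAB
  have hA' := (isUnit_iff_isUnit_det A).1 hA.isUnit
  have hB' := (isUnit_iff_isUnit_det B).1 hB.isUnit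
  have h₁ := hA.inv.posSemidef.mul_mul_conjTranspose_same (B - A)
  rw [hAB.isHermitian.eq] at h₁
  have h₂ := (hAB.add h₁).mul_mul_conjTranspose_same B⁻¹
  rw [hB.inv.isHermitian.eq] at h₂
  convert h₂ using 1
  have h₃ : B - A + (B - A) * A⁻¹ * (B - A) = B * (A⁻¹ - B⁻¹) * B := by
    simp [mul_sub, sub_mul, mul_assoc, nonsing_inv_mul _ hA', mul_nonsing_inv_cancel_left _ _ hA',
      nonsing_inv_mul _ hB']
  rw [h₃]
  simp [mul_assoc, mul_nonsing_inv _ hB', nonsing_inv_mul_cancel_left _ _ hB']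

theorem PosDef.posSemidef_smul_inv_sub_inv {A B : Matrix n n ℂ} (hA : A.PosDef) {k : ℝ}
    (hk : 0 < k) (hAB : (k • B - A).PosSemidef) : (k • A⁻¹ - B⁻¹).PosSemidef := by
  have hB : (k • B).PosDef := by simpa using hA.add_posSemidef hAB
  have hB' : B.PosDef := by simpa [smul_smul, hk.ne'] using hB.smul (inv_pos.2 hk)
  have h := (hA.posSemidef_inv_sub_inv hAB).smul hk.le
  have hinv : (k • B)⁻¹ = k⁻¹ • B⁻¹ := by
    apply inv_eq_left_inv
    simp [smul_smul, hk.ne', nonsing_inv_mul _ ((isUnit_iff_isUnit_det B).1 hB'.isUnit)]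
  simpa [hinv, smul_sub, smul_smul, hk.ne'] using h

/-- The logarithm of the real part of the determinant. -/
noncomputable def logDet (A : Matrix n n ℂ) : ℝ := Real.log A.det.re

theorem PosDef.det_re_pos {A : Matrix n n ℂ} (hA : A.PosDef) : 0 < A.det.re :=
  (Complex.lt_def.1 hA.det_pos).1

theorem hasDerivAt_det_one_add_smul (M : Matrix n n ℂ) :
    HasDerivAt (fun s : ℝ => (1 + s • M).det) M.trace 0 := by
  set p := (1 + (Polynomial.X : Polynomial ℂ) • M.map Polynomial.C).det.divX.divX
  have h : (fun s : ℝ => (1 + s • M).det) =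
      fun s : ℝ => (fun z : ℂ => 1 + M.trace * z + p.eval z * z ^ 2) (s : ℂ) := by
    ext s
    simpa using det_one_add_smul (s : ℂ) M
  rw [h]
  apply HasDerivAt.comp_ofReal (e := fun z : ℂ => 1 + M.trace * z + p.eval z * z ^ 2)
  have h₁ := (((hasDerivAt_id (0 : ℂ)).const_mul M.trace).const_add 1).add
    ((p.hasDerivAt 0).mul (hasDerivAt_pow 2 (0 : ℂ)))
  refine HasDerivAt.congr_deriv h₁ ?_
  simp

theorem hasDerivAt_logDet {Q X : Matrix n n ℂ} {t : ℝ} (h : (Q + t • X).PosDef) :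
    HasDerivAt (fun s : ℝ => logDet (Q + s • X)) (((Q + t • X)⁻¹ * X).trace.re) t := by
  set R := Q + t • X with hR
  have hu := (isUnit_iff_isUnit_det R).1 h.isUnit
  have hdet : (fun s : ℝ => (Q + s • X).det) =
      fun s : ℝ => R.det * (1 + (s - t) • (R⁻¹ * X)).det := by
    ext s
    rw [← det_mul, mul_add, mul_smul_comm, mul_nonsing_inv_cancel_left _ _ hu, hR]
    congr 1
    rw [mul_one]
    module
  have h₀ : HasDerivAt (fun s : ℝ => (Q + s • X).det) (R.det * (R⁻¹ * X).trace) t := by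
    rw [hdet]
    have := hasDerivAt_det_one_add_smul (R⁻¹ * X)
    rw [← sub_self t] at this
    exact (this.comp_sub_const t t).const_mul _
  have h₁ : HasDerivAt (fun s : ℝ => (Q + s • X).det.re) ((R.det * (R⁻¹ * X).trace).re) t :=
    Complex.reCLM.hasFDerivAt.comp_hasDerivAt t h₀
  refine (h₁.log (by rw [← hR]; exact h.det_re_pos.ne')).congr_deriv ?_
  have him : R.det.im = 0 := (Complex.lt_def.1 h.det_pos).2.symm
  rw [← hR, Complex.mul_re, him, zero_mul, sub_zero, mul_div_cancel_left₀ _ h.det_re_pos.ne']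

/-- The log-determinant (Stein) divergence. -/
noncomputable def logDetDiv (P Q : Matrix n n ℂ) : ℝ :=
  (Q⁻¹ * (P - Q)).trace.re - logDet P + logDet Q

theorem hasDerivAt_trace_sub_logDet {P Q : Matrix n n ℂ} (hP : P.PosDef) (hQ : Q.PosDef) {t : ℝ}
    (ht : t ∈ Set.Icc (0 : ℝ) 1) :
    HasDerivAt (fun s : ℝ => s * (Q⁻¹ * (P - Q)).trace.re - logDet (Q + s • (P - Q)))
      (t * traceForm (Q + t • (P - Q))⁻¹ Q⁻¹ (P - Q)) t := by
  have hR := hP.add_smul_sub hQ ht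
  refine (((hasDerivAt_id t).mul_const (Q⁻¹ * (P - Q)).trace.re).sub
    (hasDerivAt_logDet hR)).congr_deriv ?_
  generalize P - Q = X at *
  set R := Q + t • X with hRdef
  have hRu := (isUnit_iff_isUnit_det R).1 hR.isUnit
  have hQu := (isUnit_iff_isUnit_det Q).1 hQ.isUnit
  have h : t • (R⁻¹ * X * Q⁻¹ * X) = Q⁻¹ * X - R⁻¹ * X := by
    have h₁ : t • X = R - Q := by rw [hRdef]; abel
    calc t • (R⁻¹ * X * Q⁻¹ * X) = R⁻¹ * (t • X) * Q⁻¹ * X := by simp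
      _ = _ := by
        rw [h₁]
        simp [mul_sub, sub_mul, nonsing_inv_mul _ hRu, mul_assoc,
          mul_nonsing_inv_cancel_left _ _ hQu]
  have h₂ := congrArg (fun M => (trace M).re) h
  simpa [traceForm, trace_smul, trace_sub] using h₂.symm

theorem logDetDiv_triangle {P Q P₁ Q₁ P₂ Q₂ : Matrix n n ℂ} (hP : P.PosDef) (hQ : Q.PosDef)
    (hP₁ : P₁.PosDef) (hQ₁ : Q₁.PosDef) (hP₂ : P₂.PosDef) (hQ₂ : Q₂.PosDef)
    {ζ k c : ℝ} (hζ : 0 ≤ ζ) (hk : 0 < k) (hc : 0 < c)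
    (hPk : (k • P - P₁).PosSemidef) (hQk : (k • Q - Q₁).PosSemidef)
    (hPc : (c • P - P₂).PosSemidef) (hQc : (c • Q - Q₂).PosSemidef)
    (hX : (1 - ζ) • (P - Q) = (P₁ - Q₁) - ζ • (P₂ - Q₂)) :
    (1 - ζ) ^ 2 * logDetDiv P Q ≤
      (1 + ζ) * k ^ 2 * logDetDiv P₁ Q₁ + ζ * (1 + ζ) * c ^ 2 * logDetDiv P₂ Q₂ := by
  let F (P Q : Matrix n n ℂ) (s : ℝ) : ℝ :=
    s * (Q⁻¹ * (P - Q)).trace.re - logDet (Q + s • (P - Q))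
  have hF (P Q : Matrix n n ℂ) : F P Q 1 - F P Q 0 = logDetDiv P Q := by
    simp [F, logDetDiv]
  let G (s : ℝ) : ℝ := (1 + ζ) * k ^ 2 * F P₁ Q₁ s + ζ * (1 + ζ) * c ^ 2 * F P₂ Q₂ s
    - (1 - ζ) ^ 2 * F P Q s
  let q (P Q : Matrix n n ℂ) (t : ℝ) : ℝ := traceForm (Q + t • (P - Q))⁻¹ Q⁻¹ (P - Q)
  have hG (t : ℝ) (ht : t ∈ Set.Icc (0 : ℝ) 1) :
      HasDerivAt G ((1 + ζ) * k ^ 2 * (t * q P₁ Q₁ t) + ζ * (1 + ζ) * c ^ 2 * (t * q P₂ Q₂ t)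
        - (1 - ζ) ^ 2 * (t * q P Q t)) t :=
    (((hasDerivAt_trace_sub_logDet hP₁ hQ₁ ht).const_mul _).add
      ((hasDerivAt_trace_sub_logDet hP₂ hQ₂ ht).const_mul _)).sub
      ((hasDerivAt_trace_sub_logDet hP hQ ht).const_mul _)
  have hbound {P' Q' : Matrix n n ℂ} {l : ℝ} (hP' : P'.PosDef) (hQ' : Q'.PosDef) (hl : 0 < l)
      (hPl : (l • P - P').PosSemidef) (hQl : (l • Q - Q').PosSemidef) {t : ℝ}
      (ht : t ∈ Set.Icc (0 : ℝ) 1) :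
      traceForm (Q + t • (P - Q))⁻¹ Q⁻¹ (P' - Q') ≤ l ^ 2 * q P' Q' t := by
    rw [← traceForm_smul_smul]
    refine traceForm_mono (hP.add_smul_sub hQ ht).inv.posSemidef (hQ'.inv.posSemidef.smul hl.le)
      ((hP'.add_smul_sub hQ' ht).posSemidef_smul_inv_sub_inv hl ?_)
      (hQ'.posSemidef_smul_inv_sub_inv hl hQl) (hP'.isHermitian.sub hQ'.isHermitian)
    have h : l • (Q + t • (P - Q)) - (Q' + t • (P' - Q')) =
        (1 - t) • (l • Q - Q') + t • (l • P - P') := by module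
    rw [h]
    exact (hQl.smul (sub_nonneg.2 ht.2)).add (hPl.smul ht.1)
  have hmono : MonotoneOn G (Set.Icc 0 1) := by
    refine monotoneOn_of_deriv_nonneg (convex_Icc 0 1)
      (fun t ht => (hG t ht).continuousAt.continuousWithinAt)
      (fun t ht => (hG t (interior_subset ht)).differentiableAt.differentiableWithinAt)
      fun t ht => ?_
    have ht := interior_subset ht
    rw [(hG t ht).deriv]
    have h₁ := hbound hP₁ hQ₁ hk hPk hQk ht
    have h₂ := hbound hP₂ hQ₂ hc hPc hQc ht
    have h₃ := traceForm_sub_smul_le (hP.add_smul_sub hQ ht).inv.posSemidef hQ.inv.posSemidef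
      (hP₁.isHermitian.sub hQ₁.isHermitian) (hP₂.isHermitian.sub hQ₂.isHermitian) hζ
    have h₄ : traceForm (Q + t • (P - Q))⁻¹ Q⁻¹ ((1 - ζ) • (P - Q)) = (1 - ζ) ^ 2 * q P Q t := by
      simp [traceForm, q, trace_smul, pow_two, mul_assoc]
    rw [← hX, h₄] at h₃
    have h₅ := mul_le_mul_of_nonneg_left h₁ (by positivity : 0 ≤ 1 + ζ)
    have h₆ := mul_le_mul_of_nonneg_left h₂ (by positivity : 0 ≤ ζ * (1 + ζ))
    have h₇ := mul_nonneg ht.1 (sub_nonneg.2 (h₃.trans (add_le_add h₅ h₆)))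
    linarith
  have h := hmono (Set.left_mem_Icc.2 zero_le_one) (Set.right_mem_Icc.2 zero_le_one) zero_le_one
  simp only [G] at h
  rw [← hF, ← hF, ← hF]
  linarith

end Matrix

namespace Matrix.IsHermitian

variable {n : Type*} [Fintype n] [DecidableEq n] {A B : Matrix n n ℂ}

theorem cfc_mul_cfc (hA : A.IsHermitian) (f g : ℝ → ℝ) :
    hA.cfc f * hA.cfc g = hA.cfc (f * g) := by
  simp only [IsHermitian.cfc, ← map_mul, diagonal_mul_diagonal]
  congr 2
  ext
  simp

theorem cfc_one_eq (hA : A.IsHermitian) : hA.cfc 1 = 1 := by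
  rw [IsHermitian.cfc, ← map_one (Unitary.conjStarAlgAut ℂ _ hA.eigenvectorUnitary),
    ← diagonal_one]
  congr 2

theorem cfc_id_eq (hA : A.IsHermitian) : hA.cfc id = A :=
  hA.spectral_theorem.symm

theorem cfc_add_const (hA : A.IsHermitian) (r : ℝ) : hA.cfc (· + r) = A + r • 1 := by
  have h : A + r • (1 : Matrix n n ℂ) = hA.cfc id + (r : ℂ) • hA.cfc 1 := by
    rw [cfc_id_eq, cfc_one_eq, Complex.coe_smul]
  rw [h]
  simp only [IsHermitian.cfc, ← map_smul, ← map_add]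
  congr 1
  ext i j
  by_cases hij : i = j <;> simp [diagonal, hij]

theorem inv_add_smul_one (hA : A.IsHermitian) {r : ℝ} (h : ∀ i, hA.eigenvalues i + r ≠ 0) :
    (A + r • 1)⁻¹ = hA.cfc fun x => (x + r)⁻¹ := by
  apply inv_eq_left_inv
  rw [← hA.cfc_add_const, cfc_mul_cfc, ← hA.cfc_one_eq, IsHermitian.cfc, IsHermitian.cfc]
  congr 2
  ext i
  simp only [Function.comp_apply, Pi.mul_apply, inv_mul_cancel₀ (h i), Pi.one_apply]

theorem det_cfc (hA : A.IsHermitian) (f : ℝ → ℝ) :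
    (hA.cfc f).det = ((∏ i, f (hA.eigenvalues i) : ℝ) : ℂ) := by
  simp [IsHermitian.cfc, -Unitary.conjStarAlgAut_apply]

theorem logDet_add_smul_one (hA : A.IsHermitian) {r : ℝ}
    (h : ∀ i, hA.eigenvalues i + r ≠ 0) :
    logDet (A + r • 1) = ∑ i, Real.log (hA.eigenvalues i + r) := by
  rw [logDet, ← hA.cfc_add_const, det_cfc, Complex.ofReal_re, Real.log_prod fun i _ => h i]

/-- The squared overlaps between the eigenvectors of two Hermitian matrices. -/
noncomputable def overlap (hA : A.IsHermitian) (hB : B.IsHermitian) (i j : n) : ℝ :=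
  Complex.normSq ((star (hA.eigenvectorUnitary : Matrix n n ℂ) *
    (hB.eigenvectorUnitary : Matrix n n ℂ)) i j)

theorem overlap_nonneg (hA : A.IsHermitian) (hB : B.IsHermitian) (i j : n) :
    0 ≤ hA.overlap hB i j :=
  Complex.normSq_nonneg _

theorem re_trace_cfc_mul_cfc (hA : A.IsHermitian) (hB : B.IsHermitian) (f g : ℝ → ℝ) :
    (hA.cfc f * hB.cfc g).trace.re =
      ∑ i, ∑ j, hA.overlap hB i j * (f (hA.eigenvalues i) * g (hB.eigenvalues j)) := by
  set U := (hA.eigenvectorUnitary : Matrix n n ℂ) with hU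
  set V := (hB.eigenvectorUnitary : Matrix n n ℂ) with hV
  set D := diagonal ((RCLike.ofReal : ℝ → ℂ) ∘ f ∘ hA.eigenvalues) with hD
  set E := diagonal ((RCLike.ofReal : ℝ → ℂ) ∘ g ∘ hB.eigenvalues) with hE
  have h₁ : (hA.cfc f * hB.cfc g).trace = (D * (star U * V) * (E * star (star U * V))).trace := by
    rw [IsHermitian.cfc, IsHermitian.cfc, Unitary.conjStarAlgAut_apply,
      Unitary.conjStarAlgAut_apply]
    simp only [← hU, ← hV, ← hD, ← hE, star_mul, star_star, mul_assoc]
    rw [trace_mul_comm]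
    simp only [mul_assoc]
  rw [h₁]
  simp only [trace, diag_apply, mul_apply (M := D * (star U * V)), Complex.re_sum]
  refine Finset.sum_congr rfl fun i _ => Finset.sum_congr rfl fun j _ => ?_
  rw [hD, hE, diagonal_mul, diagonal_mul, star_apply, overlap, ← hU, ← hV]
  simp [Complex.normSq_apply]
  ring

theorem sum_overlap_left (hA : A.IsHermitian) (hB : B.IsHermitian) (f : ℝ → ℝ) :
    ∑ i, ∑ j, hA.overlap hB i j * f (hA.eigenvalues i) = ∑ i, f (hA.eigenvalues i) := by
  have h := hA.re_trace_cfc_mul_cfc hB f 1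
  rw [cfc_one_eq, mul_one, IsHermitian.cfc, Unitary.conjStarAlgAut_apply, trace_mul_comm,
    ← mul_assoc, Unitary.coe_star_mul_self, one_mul] at h
  simpa [trace] using h.symm

theorem sum_overlap_right (hA : A.IsHermitian) (hB : B.IsHermitian) (g : ℝ → ℝ) :
    ∑ i, ∑ j, hA.overlap hB i j * g (hB.eigenvalues j) = ∑ j, g (hB.eigenvalues j) := by
  have h := hA.re_trace_cfc_mul_cfc hB 1 g
  rw [cfc_one_eq, one_mul, IsHermitian.cfc, Unitary.conjStarAlgAut_apply, trace_mul_comm,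
    ← mul_assoc, Unitary.coe_star_mul_self, one_mul] at h
  simpa [trace] using h.symm

theorem sum_eigenvalues_eq_re_trace (hA : A.IsHermitian) :
    ∑ i, hA.eigenvalues i = A.trace.re := by
  simp [hA.trace_eq_sum_eigenvalues]

theorem sum_overlap_sub (hA : A.IsHermitian) (hB : B.IsHermitian) (h : A.trace = B.trace) :
    ∑ i, ∑ j, hA.overlap hB i j * (hB.eigenvalues j - hA.eigenvalues i) = 0 := by
  have h₁ := hA.sum_overlap_left hB id
  have h₂ := hA.sum_overlap_right hB id
  simp only [id, sum_eigenvalues_eq_re_trace] at h₁ h₂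
  simp only [mul_sub, Finset.sum_sub_distrib, h₁, h₂, h, sub_self]

theorem logDetDiv_add_smul_one (hA : A.IsHermitian) (hB : B.IsHermitian) {r : ℝ}
    (h : ∀ i, hA.eigenvalues i + r ≠ 0) (h' : ∀ i, hB.eigenvalues i + r ≠ 0) :
    logDetDiv (A + r • 1) (B + r • 1) = ∑ i, ∑ j, hA.overlap hB i j *
      ((hA.eigenvalues i - hB.eigenvalues j) / (hB.eigenvalues j + r)
        - Real.log (hA.eigenvalues i + r) + Real.log (hB.eigenvalues j + r)) := by
  have h₁ : ((B + r • 1)⁻¹ * (A + r • 1 - (B + r • 1))).trace =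
      (hA.cfc id * hB.cfc fun x => (x + r)⁻¹).trace
        - (hA.cfc 1 * hB.cfc (id * fun x => (x + r)⁻¹)).trace := by
    rw [add_sub_add_right_eq_sub, hB.inv_add_smul_one h', mul_sub, trace_sub, cfc_one_eq,
      ← cfc_mul_cfc, cfc_id_eq, cfc_id_eq, one_mul, trace_mul_comm, trace_mul_comm B]
  rw [logDetDiv, h₁, hA.logDet_add_smul_one h, hB.logDet_add_smul_one h', Complex.sub_re,
    re_trace_cfc_mul_cfc, re_trace_cfc_mul_cfc,
    ← hA.sum_overlap_left hB (fun x => Real.log (x + r)),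
    ← hA.sum_overlap_right hB (fun x => Real.log (x + r))]
  simp only [← Finset.sum_sub_distrib, ← Finset.sum_add_distrib]
  refine Finset.sum_congr rfl fun i _ => Finset.sum_congr rfl fun j _ => ?_
  simp only [id, Pi.mul_apply, Pi.one_apply]
  ring

/-- An antiderivative in `r` of the log-determinant divergence of `A + r` and `B + r`. -/
noncomputable def shiftEntropy (hA : A.IsHermitian) (hB : B.IsHermitian) (r : ℝ) : ℝ :=
  ∑ i, ∑ j, hA.overlap hB i j * ((hA.eigenvalues i + r) *
    (Real.log (hB.eigenvalues j + r) - Real.log (hA.eigenvalues i + r)))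

theorem hasDerivAt_shiftEntropy (hA : A.PosSemidef) (hB : B.PosSemidef) {r : ℝ} (hr : 0 < r) :
    HasDerivAt (hA.isHermitian.shiftEntropy hB.isHermitian)
      (logDetDiv (A + r • 1) (B + r • 1)) r := by
  have ha (i : n) : hA.isHermitian.eigenvalues i + r ≠ 0 :=
    (add_pos_of_nonneg_of_pos (hA.eigenvalues_nonneg i) hr).ne'
  have hb (i : n) : hB.isHermitian.eigenvalues i + r ≠ 0 :=
    (add_pos_of_nonneg_of_pos (hB.eigenvalues_nonneg i) hr).ne'
  rw [logDetDiv_add_smul_one _ _ ha hb]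
  refine HasDerivAt.fun_sum fun i _ => HasDerivAt.fun_sum fun j _ => HasDerivAt.const_mul _ ?_
  have h₁ := (hasDerivAt_id r).const_add (hA.isHermitian.eigenvalues i)
  have h₂ := (hasDerivAt_id r).const_add (hB.isHermitian.eigenvalues j)
  refine (h₁.mul ((h₂.log (hb j)).sub (h₁.log (ha i)))).congr_deriv ?_
  have := ha i
  have := hb j
  simp only [id, Pi.sub_apply]
  field_simp
  ring

theorem continuousOn_shiftEntropy (hA : A.IsHermitian) (hB : B.PosDef) :
    ContinuousOn (hA.shiftEntropy hB.isHermitian) (Set.Ici 0) := by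
  refine continuousOn_finsetSum _ fun i _ => continuousOn_finsetSum _ fun j _ =>
    continuousOn_const.mul ?_
  simp only [mul_sub]
  refine ContinuousOn.sub ?_ (Continuous.continuousOn ?_)
  · refine ContinuousOn.mul (by fun_prop) (ContinuousOn.log (by fun_prop) fun r hr => ?_)
    exact (add_pos_of_pos_of_nonneg (hB.eigenvalues_pos j) hr).ne'
  · exact Real.continuous_mul_log.comp (continuous_const.add continuous_id)

theorem _root_.Real.tendsto_add_mul_log_sub_log (a b : ℝ) :
    Filter.Tendsto (fun r => (a + r) * (Real.log (b + r) - Real.log (a + r))) Filter.atTop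
      (nhds (b - a)) := by
  refine ((Real.tendsto_mul_log_one_add_div_atTop (b - a)).comp
    (Filter.tendsto_atTop_add_const_left _ a Filter.tendsto_id)).congr' ?_
  filter_upwards [Filter.eventually_gt_atTop (-a), Filter.eventually_gt_atTop (-b)] with r ha hb
  have ha : 0 < a + r := by linarith
  have hb : 0 < b + r := by linarith
  rw [← Real.log_div hb.ne' ha.ne']
  simp only [Function.comp_apply, id]
  congr 2
  field_simp
  ring

theorem tendsto_shiftEntropy (hA : A.IsHermitian) (hB : B.IsHermitian) (h : A.trace = B.trace) :
    Filter.Tendsto (hA.shiftEntropy hB) Filter.atTop (nhds 0) := by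
  rw [← hA.sum_overlap_sub hB h]
  exact tendsto_finsetSum _ fun i _ => tendsto_finsetSum _ fun j _ =>
    (Real.tendsto_add_mul_log_sub_log _ _).const_mul _

end Matrix.IsHermitian

theorem relEnt_eq_sum_overlap {d : ℕ} {ρ σ : Matrix (Fin d) (Fin d) ℂ} (hρ : ρ.IsHermitian)
    (hσ : σ.IsHermitian) :
    relEnt ρ σ = ∑ i, ∑ j, hρ.overlap hσ i j *
      (hρ.eigenvalues i * (Real.log (hρ.eigenvalues i) - Real.log (hσ.eigenvalues j))) := by
  have h : ρ * (matLog ρ - matLog σ) =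
      hρ.cfc (id * Real.log) * hσ.cfc 1 - hρ.cfc id * hσ.cfc Real.log := by
    rw [← hρ.cfc_mul_cfc, hρ.cfc_id_eq, hσ.cfc_one_eq, matLog, matLog, dif_pos hρ, dif_pos hσ,
      mul_sub, mul_one]
  rw [relEnt, h, trace_sub, Complex.sub_re, hρ.re_trace_cfc_mul_cfc hσ,
    hρ.re_trace_cfc_mul_cfc hσ]
  simp only [← Finset.sum_sub_distrib]
  refine Finset.sum_congr rfl fun i _ => Finset.sum_congr rfl fun j _ => ?_
  simp only [id, Pi.mul_apply, Pi.one_apply]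
  ring

theorem shiftEntropy_zero {d : ℕ} {ρ σ : Matrix (Fin d) (Fin d) ℂ} (hρ : ρ.IsHermitian)
    (hσ : σ.IsHermitian) : hρ.shiftEntropy hσ 0 = -relEnt ρ σ := by
  rw [relEnt_eq_sum_overlap hρ hσ, IsHermitian.shiftEntropy]
  simp only [← Finset.sum_neg_distrib, add_zero]
  refine Finset.sum_congr rfl fun i _ => Finset.sum_congr rfl fun j _ => ?_
  ring

/-- **Klein inequality**: the relative entropy is nonnegative. -/
theorem relEnt_nonneg {d : ℕ} {ρ σ : Matrix (Fin d) (Fin d) ℂ} (hρ : ρ.PosSemidef)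
    (hσ : σ.PosDef) (h : ρ.trace = σ.trace) : 0 ≤ relEnt ρ σ := by
  have h₀ := hρ.isHermitian.sum_overlap_sub hσ.isHermitian h
  have h₁ : relEnt ρ σ = relEnt ρ σ + _ := (add_zero _).symm.trans (congrArg _ h₀.symm)
  rw [h₁, relEnt_eq_sum_overlap hρ.isHermitian hσ.isHermitian]
  simp only [← Finset.sum_add_distrib, ← mul_add]
  refine Finset.sum_nonneg fun i _ => Finset.sum_nonneg fun j _ =>
    mul_nonneg (hρ.isHermitian.overlap_nonneg hσ.isHermitian i j) ?_
  have hs := hσ.eigenvalues_pos j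
  rcases (hρ.eigenvalues_nonneg i).eq_or_lt with hp | hp
  · rw [← hp]
    simpa using hs.le
  · have h₁ := mul_le_mul_of_nonneg_left (Real.log_le_sub_one_of_pos (div_pos hs hp)) hp.le
    rw [Real.log_div hs.ne' hp.ne', mul_sub, mul_sub, mul_div_cancel₀ _ hp.ne'] at h₁
    linarith

theorem relEnt_triangle {d : ℕ} {ρ σ ω η : Matrix (Fin d) (Fin d) ℂ} (hρ : ρ.PosSemidef)
    (hσ : σ.PosDef) (hω : ω.PosDef) (hη : η.PosDef) (hρσ : ρ.trace = σ.trace)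
    (hρω : ρ.trace = ω.trace) (hρη : ρ.trace = η.trace) {ζ k c : ℝ} (hζ : 0 ≤ ζ) (hk : 1 ≤ k)
    (hc : 1 ≤ c) (hωσ : (k • σ - ω).PosSemidef) (hησ : (c • σ - η).PosSemidef)
    (h : ω = (1 - ζ) • σ + ζ • η) :
    (1 - ζ) ^ 2 * relEnt ρ σ ≤ (1 + ζ) * k * relEnt ρ ω + ζ * (1 + ζ) * c * relEnt ρ η := by
  have hk₀ : 0 < k := by linarith
  have hc₀ : 0 < c := by linarith
  let S := hρ.isHermitian.shiftEntropy hσ.isHermitian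
  let W := hρ.isHermitian.shiftEntropy hω.isHermitian
  let E := hρ.isHermitian.shiftEntropy hη.isHermitian
  let G (r : ℝ) : ℝ := (1 + ζ) * k * W (k * r) + ζ * (1 + ζ) * c * E (c * r) - (1 - ζ) ^ 2 * S r
  have hmul {l : ℝ} (hl : 0 < l) : Filter.Tendsto (l * ·) Filter.atTop Filter.atTop :=
    Filter.tendsto_id.const_mul_atTop hl
  have hmaps {l : ℝ} (hl : 0 < l) : Set.MapsTo (l * ·) (Set.Ici 0) (Set.Ici 0) :=
    fun r hr => mul_nonneg hl.le hr
  have hlim : Filter.Tendsto G Filter.atTop (nhds 0) := by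
    have := ((((hρ.isHermitian.tendsto_shiftEntropy hω.isHermitian hρω).comp
      (hmul hk₀)).const_mul ((1 + ζ) * k)).add
      (((hρ.isHermitian.tendsto_shiftEntropy hη.isHermitian hρη).comp
      (hmul hc₀)).const_mul (ζ * (1 + ζ) * c))).sub
      ((hρ.isHermitian.tendsto_shiftEntropy hσ.isHermitian hρσ).const_mul ((1 - ζ) ^ 2))
    simpa using this
  have hcont : ContinuousOn G (Set.Ici 0) :=
    ((((IsHermitian.continuousOn_shiftEntropy hρ.isHermitian hω).comp
      (by fun_prop) (hmaps hk₀)).const_mul _).add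
      (((IsHermitian.continuousOn_shiftEntropy hρ.isHermitian hη).comp
      (by fun_prop) (hmaps hc₀)).const_mul _)).sub
      ((IsHermitian.continuousOn_shiftEntropy hρ.isHermitian hσ).const_mul _)
  have hcomp {τ : Matrix (Fin d) (Fin d) ℂ} (hτ : τ.PosDef) {l r : ℝ} (hl : 0 < l) (hr : 0 < r) :
      HasDerivAt (fun r => hρ.isHermitian.shiftEntropy hτ.isHermitian (l * r))
        (logDetDiv (ρ + (l * r) • 1) (τ + (l * r) • 1) * l) r := by
    have h₁ := IsHermitian.hasDerivAt_shiftEntropy hρ hτ.posSemidef (mul_pos hl hr)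
    exact h₁.comp r (by simpa using (hasDerivAt_id r).const_mul l)
  have hG {r : ℝ} (hr : 0 < r) := (((hcomp hω hk₀ hr).const_mul ((1 + ζ) * k)).add
    ((hcomp hη hc₀ hr).const_mul (ζ * (1 + ζ) * c))).sub
    ((IsHermitian.hasDerivAt_shiftEntropy hρ hσ.posSemidef hr).const_mul ((1 - ζ) ^ 2))
  have hmono : MonotoneOn G (Set.Ici 0) := by
    refine monotoneOn_of_deriv_nonneg (convex_Ici 0) hcont ?_ ?_ <;> rw [interior_Ici]
    · exact fun r hr => (hG hr).differentiableAt.differentiableWithinAt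
    intro r hr
    have hr : 0 < r := hr
    have hderiv : deriv G r = _ := (hG hr).deriv
    have hone {s : ℝ} (hs : 0 < s) : (s • (1 : Matrix (Fin d) (Fin d) ℂ)).PosDef :=
      PosDef.one.smul hs
    have hshift {τ : Matrix (Fin d) (Fin d) ℂ} {l : ℝ} (hτ : (l • σ - τ).PosSemidef) :
        (l • (σ + r • 1) - (τ + (l * r) • 1)).PosSemidef := by
      convert hτ using 1
      module
    have hshift' {l : ℝ} (hl : 1 ≤ l) :
        (l • (ρ + r • 1) - (ρ + (l * r) • 1)).PosSemidef := by
      convert hρ.smul (sub_nonneg.2 hl) using 1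
      module
    have key := logDetDiv_triangle (PosDef.posSemidef_add hρ (hone hr)) (hσ.add (hone hr))
      (PosDef.posSemidef_add hρ (hone (mul_pos hk₀ hr))) (hω.add (hone (mul_pos hk₀ hr)))
      (PosDef.posSemidef_add hρ (hone (mul_pos hc₀ hr))) (hη.add (hone (mul_pos hc₀ hr)))
      hζ hk₀ hc₀ (hshift' hk) (hshift hωσ) (hshift' hc) (hshift hησ) (by rw [h]; module)
    rw [hderiv]
    linarith
  have hle : G 0 ≤ 0 := by
    refine ge_of_tendsto hlim ?_
    filter_upwards [Filter.eventually_ge_atTop 0] with r hr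
    exact hmono Set.self_mem_Ici hr hr
  simp only [G, S, W, E, mul_zero, shiftEntropy_zero] at hle
  linarith

/-- **Theorem 1.4 (first inequality).** Triangle-like relative entropy comparison. -/
theorem triangle_like_relEnt_comparison_first
    (d : ℕ) (ρ σ ω : Matrix (Fin d) (Fin d) ℂ)
    (hρ : IsDensity ρ) (hσ : IsDensity σ) (hω : IsDensity ω)
    (hσpd : σ.PosDef)
    (ζ c : ℝ) (hζ : ζ ∈ Set.Ioo (0:ℝ) 1) (hc : 1 ≤ c)
    (h₁ : (ω - (1 - ζ) • σ).PosSemidef)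
    (h₂ : ((1 + ζ * (c - 1)) • σ - ω).PosSemidef) :
    (ζ⁻¹ • (ω - (1 - ζ) • σ)).PosSemidef ∧
    (ζ⁻¹ • (ω - (1 - ζ) • σ)).trace = 1 ∧
    ((ζ⁻¹ • (ω - (1 - ζ) • σ)).PosDef →
      (1 - ζ) ^ 2 * relEnt ρ σ
        ≤ (1 + ζ * (c + 1) + 2 * ζ ^ 2 * (c - 1)) * relEnt ρ ω
          + ζ * (2 + ζ) * c * relEnt ρ (ζ⁻¹ • (ω - (1 - ζ) • σ))) := by
  have hζ₀ := hζ.1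
  set η := ζ⁻¹ • (ω - (1 - ζ) • σ) with hη
  have htr : η.trace = 1 := by
    rw [hη, trace_smul, trace_sub, trace_smul, hω.2, hσ.2]
    simp [← Complex.coe_smul, hζ₀.ne']
  have hωη : ω = (1 - ζ) • σ + ζ • η := by
    rw [hη, smul_smul, mul_inv_cancel₀ hζ₀.ne']
    module
  refine ⟨h₁.smul (inv_nonneg.2 hζ₀.le), htr, fun hηpd => ?_⟩
  have hωpd : ω.PosDef := by
    rw [hωη]
    exact (hσpd.smul (sub_pos.2 hζ.2)).add (hηpd.smul hζ₀)
  have hησ : (c • σ - η).PosSemidef := by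
    convert h₂.smul (inv_nonneg.2 hζ₀.le) using 1
    have h : c • σ = ζ⁻¹ • (ζ * c) • σ := by
      rw [smul_smul, inv_mul_cancel_left₀ hζ₀.ne']
    rw [h, hη]
    module
  have hk : 0 ≤ ζ * (c - 1) := mul_nonneg hζ₀.le (sub_nonneg.2 hc)
  have key := relEnt_triangle hρ.1 hσpd hωpd hηpd (hρ.2.trans hσ.2.symm) (hρ.2.trans hω.2.symm)
    (hρ.2.trans htr.symm) hζ₀.le (by linarith : 1 ≤ 1 + ζ * (c - 1)) hc h₂ hησ hωη
  have hDω := mul_nonneg (add_nonneg hζ₀.le (mul_nonneg hζ₀.le hk))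
    (relEnt_nonneg hρ.1 hωpd (hρ.2.trans hω.2.symm))
  have hDη := mul_nonneg (mul_nonneg hζ₀.le (zero_le_one.trans hc))
    (relEnt_nonneg hρ.1 hηpd (hρ.2.trans htr.symm))
  linarith
end
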